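/- arXiv:2410.11349 — 3 statements merged into one kernel-verified Lean document; each statement's English description precedes it below -/
import Mathlib

section
/- Let X_1, …, X_n be independent under Ê with sup_{P ∈ 𝒫} E_P[|X_i|²] < ∞ for each i. Then for every P ∈ 𝒫 and every i ≤ n, the (componentwise) conditional expectation satisfies E_P[X_i | F_{i−1}](ω) ∈ Θ_i for P-almost every ω ∈ Ω. -/
open MeasureTheory Set
open scoped NNReal ENNReal RealInnerProductSpace

noncomputable section

/-- Bounded Lipschitz real-valued function on a (pseudo)metric space. -/
def IsBLip {α : Type*} [PseudoMetricSpace α] (ψ : α → ℝ) : Prop :=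
  (∃ K : ℝ≥0, LipschitzWith K ψ) ∧ ∃ C : ℝ, ∀ x, |ψ x| ≤ C

variable {Ω : Type*} [MeasurableSpace Ω] [TopologicalSpace Ω]

/-- The sublinear expectation `Ê[f] = sup_{P ∈ Pset} E_P[f]`. -/
def hatE (Pset : Set (ProbabilityMeasure Ω)) (f : Ω → ℝ) : ℝ :=
  ⨆ P : Pset, ∫ ω, f ω ∂((P : ProbabilityMeasure Ω) : Measure Ω)

/-- Convexity of a set of probability measures. -/
def ConvexPM (Pset : Set (ProbabilityMeasure Ω)) : Prop :=
  ∀ P ∈ Pset, ∀ Q ∈ Pset, ∀ a : ℝ≥0, a ≤ 1 →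
    ∃ R ∈ Pset, (R : Measure Ω)
      = (a : ℝ≥0∞) • (P : Measure Ω) + ((1 - a : ℝ≥0) : ℝ≥0∞) • (Q : Measure Ω)

/-- `σ(X_1, …, X_i)` for a finite family of `ℝ^d`-valued maps (0-indexed:
`F X i` is generated by `X 0, …, X (i-1)`; `F X 0` is trivial). -/
def sigmaF {d n : ℕ} (X : Fin n → Ω → EuclideanSpace ℝ (Fin d)) (i : ℕ) :
    MeasurableSpace Ω :=
  ⨆ j : Fin n, ⨆ _ : (j : ℕ) < i, MeasurableSpace.comap (X j) (borel _)

/-- Independence of `X_1, …, X_n` (0-indexed) under the sublinear expectation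
associated with `Pset`. -/
def IndepUnder (Pset : Set (ProbabilityMeasure Ω)) {d n : ℕ}
    (X : Fin n → Ω → EuclideanSpace ℝ (Fin d)) : Prop :=
  ∀ (i : ℕ) (hi : i + 1 < n)
    (ψ : ((Fin (i + 1) → EuclideanSpace ℝ (Fin d)) × EuclideanSpace ℝ (Fin d)) → ℝ),
    IsBLip ψ →
    hatE Pset (fun ω => ψ ((fun j => X ⟨j.1, lt_trans j.2 hi⟩ ω), X ⟨i + 1, hi⟩ ω))
      = hatE Pset (fun ω =>
          hatE Pset (fun ω' => ψ ((fun j => X ⟨j.1, lt_trans j.2 hi⟩ ω), X ⟨i + 1, hi⟩ ω')))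

/-- Uniformly bounded second moments over `Pset`. -/
def HasBddMoment2 (Pset : Set (ProbabilityMeasure Ω)) {d : ℕ}
    (X : Ω → EuclideanSpace ℝ (Fin d)) : Prop :=
  ∃ C : ℝ, ∀ P ∈ Pset, Integrable (fun ω => ‖X ω‖ ^ 2) (P : Measure Ω) ∧
    ∫ ω, ‖X ω‖ ^ 2 ∂(P : Measure Ω) ≤ C

/-- `Θ_X = {θ : ⟨θ, p⟩ ≤ Ê[⟨p, X⟩] for all p}`. -/
def ThetaSet (Pset : Set (ProbabilityMeasure Ω)) {d : ℕ}
    (X : Ω → EuclideanSpace ℝ (Fin d)) : Set (EuclideanSpace ℝ (Fin d)) :=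
  {θ | ∀ p : EuclideanSpace ℝ (Fin d), ⟪θ, p⟫ ≤ hatE Pset (fun ω => ⟪p, X ω⟫)}

/-- The truncation of a real number to the interval `[-N, N]`. -/
def truncReal (N z : ℝ) : ℝ := max (-N) (min N z)

lemma abs_truncReal_le {N : ℝ} (hN : 0 ≤ N) (z : ℝ) : |truncReal N z| ≤ N := by
  rw [truncReal, abs_le]
  exact ⟨le_max_left _ _, max_le (by linarith) (min_le_left _ _)⟩

lemma lipschitzWith_truncReal (N : ℝ) : LipschitzWith 1 (truncReal N) :=
  (LipschitzWith.id.const_min N).const_max (-N)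

lemma abs_sub_truncReal_le {N : ℝ} (hN : 0 < N) (z : ℝ) : |z - truncReal N z| ≤ z ^ 2 / N := by
  rw [le_div_iff₀ hN, truncReal]
  rcases le_total N z with h | h
  · rw [min_eq_left h, max_eq_right (by linarith), abs_of_nonneg (by linarith)]
    nlinarith
  · rw [min_eq_right h]
    rcases le_total (-N) z with h' | h'
    · rw [max_eq_right h', sub_self, abs_zero, zero_mul]
      positivity
    · rw [max_eq_left h', abs_of_nonpos (by linarith)]
      nlinarith

/-- The product of two bounded Lipschitz functions is bounded Lipschitz. -/
lemma IsBLip.mul {α : Type*} [PseudoMetricSpace α] {f g : α → ℝ} (hf : IsBLip f)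
    (hg : IsBLip g) : IsBLip (fun x => f x * g x) := by
  obtain ⟨⟨K, hK⟩, C, hC⟩ := hf
  obtain ⟨⟨L, hL⟩, D, hD⟩ := hg
  refine ⟨⟨(|C| * L + |D| * K).toNNReal, LipschitzWith.of_dist_le_mul fun x y => ?_⟩,
    |C| * |D|, fun x => ?_⟩
  · rw [Real.coe_toNNReal _ (by positivity), Real.dist_eq]
    have h1 : |g x - g y| ≤ L * dist x y := by simpa [Real.dist_eq] using hL.dist_le_mul x y
    have h2 : |f x - f y| ≤ K * dist x y := by simpa [Real.dist_eq] using hK.dist_le_mul x y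
    calc |f x * g x - f y * g y| = |f x * (g x - g y) + g y * (f x - f y)| := by ring_nf
      _ ≤ |f x| * |g x - g y| + |g y| * |f x - f y| := by
        rw [← abs_mul, ← abs_mul]; exact abs_add_le _ _
      _ ≤ |C| * (L * dist x y) + |D| * (K * dist x y) := by
        have := (hC x).trans (le_abs_self C)
        have := (hD y).trans (le_abs_self D)
        gcongr ?_ * ?_ + ?_ * ?_
      _ = _ := by ring
  · rw [abs_mul]
    exact mul_le_mul ((hC x).trans (le_abs_self C)) ((hD x).trans (le_abs_self D))
      (abs_nonneg _) (abs_nonneg _)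

lemma IsBLip.comp {α β : Type*} [PseudoMetricSpace α] [PseudoMetricSpace β] {f : β → ℝ}
    (hf : IsBLip f) {K : ℝ≥0} {u : α → β} (hu : LipschitzWith K u) :
    IsBLip (fun x => f (u x)) := by
  obtain ⟨⟨L, hL⟩, C, hC⟩ := hf
  exact ⟨⟨L * K, hL.comp hu⟩, C, fun x => hC _⟩

/-- A function has nonpositive conditional expectation given `Y` as soon as it integrates
nonpositively against all `[0, 1]`-valued Lipschitz functions of `Y`. -/
lemma condExp_comap_nonpos_of_lipschitz {Ω S : Type*} [MeasurableSpace Ω] [PseudoMetricSpace S]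
    [MeasurableSpace S] [BorelSpace S] {μ : Measure Ω} [IsFiniteMeasure μ] {Y : Ω → S}
    (hY : Measurable Y) {W : Ω → ℝ} (hW : Integrable W μ)
    (h : ∀ φ : S → ℝ, (∃ K : ℝ≥0, LipschitzWith K φ) → (∀ x, 0 ≤ φ x) → (∀ x, φ x ≤ 1) →
      ∫ ω, φ (Y ω) * W ω ∂μ ≤ 0) :
    μ[W | MeasurableSpace.comap Y inferInstance] ≤ᵐ[μ] 0 := by
  have hclosed : ∀ F : Set S, IsClosed F → ∫ ω in Y ⁻¹' F, W ω ∂μ ≤ 0 := by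
    intro F hF
    have hpos : ∀ k : ℕ, (0 : ℝ) < 1 / ((k : ℝ) + 1) := fun k => by positivity
    have hlim := thickenedIndicator_tendsto_indicator_closure hpos
      tendsto_one_div_add_atTop_nhds_zero_nat F
    rw [hF.closure_eq, tendsto_pi_nhds] at hlim
    rw [← integral_indicator (hY hF.measurableSet)]
    refine le_of_tendsto (tendsto_integral_of_dominated_convergence (fun ω => ‖W ω‖)
      (F := fun k ω => (thickenedIndicator (hpos k) F (Y ω) : ℝ) * W ω)
      (fun k => ?_) hW.norm (fun k => ?_) ?_) (Filter.Eventually.of_forall fun k => ?_)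
    · refine AEStronglyMeasurable.mul ?_ hW.1
      exact ((NNReal.continuous_coe.comp
        (thickenedIndicator (hpos k) F).continuous).measurable.comp hY).aestronglyMeasurable
    · refine Filter.Eventually.of_forall fun ω => ?_
      rw [norm_mul]
      refine mul_le_of_le_one_left (norm_nonneg _) ?_
      rw [Real.norm_eq_abs, NNReal.abs_eq]
      exact_mod_cast thickenedIndicator_le_one (hpos k) F (Y ω)
    · refine Filter.Eventually.of_forall fun ω => ?_
      have h1 := ((NNReal.continuous_coe.tendsto _).comp (hlim (Y ω))).mul_const (W ω)
      have heq : (Y ⁻¹' F).indicator W ω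
          = ((F.indicator (fun _ => (1 : ℝ≥0)) (Y ω) : ℝ≥0) : ℝ) * W ω := by
        by_cases hω : Y ω ∈ F <;> simp [hω]
      rw [heq]
      exact h1
    · refine h (fun x => (thickenedIndicator (hpos k) F x : ℝ))
        ⟨1 * (1 / ((k : ℝ) + 1)).toNNReal⁻¹, ?_⟩
        (fun x => NNReal.coe_nonneg _)
        (fun x => by exact_mod_cast thickenedIndicator_le_one (hpos k) F x)
      exact LipschitzWith.comp (Kf := 1) (LipschitzWith.of_dist_le_mul fun x y => by
        simp [NNReal.dist_eq, Real.dist_eq]) (lipschitzWith_thickenedIndicator (hpos k) F)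
  set G := μ[W | MeasurableSpace.comap Y inferInstance] with hG
  obtain ⟨A, hA, hAeq⟩ :
      MeasurableSet[MeasurableSpace.comap Y inferInstance] {ω | 0 < G ω} :=
    stronglyMeasurable_condExp.measurable measurableSet_Ioi
  by_contra hcon
  have hne : μ.map Y A ≠ 0 := by
    rw [Measure.map_apply hY hA, hAeq]
    intro h0
    refine hcon ?_
    rw [Filter.EventuallyLE, ae_iff]
    simpa only [Pi.zero_apply, not_le] using h0
  obtain ⟨F, hFA, hF, hFpos⟩ := hA.exists_lt_isClosed_of_ne_top (measure_ne_top _ _)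
    (pos_iff_ne_zero.mpr hne)
  have hFm : MeasurableSet[MeasurableSpace.comap Y inferInstance] (Y ⁻¹' F) := ⟨F, hF.measurableSet, rfl⟩
  rw [Measure.map_apply hY hF.measurableSet] at hFpos
  have hsub : ∀ ω ∈ Y ⁻¹' F, 0 < G ω := fun ω hω => by
    have : ω ∈ Y ⁻¹' A := hFA hω
    rwa [hAeq] at this
  have hint := setIntegral_condExp hY.comap_le hW hFm
  rw [← hG] at hint
  have hposint : 0 < ∫ ω in Y ⁻¹' F, G ω ∂μ := by
    rw [setIntegral_pos_iff_support_of_nonneg_ae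
      ((ae_restrict_iff' (hY hF.measurableSet)).mpr (Filter.Eventually.of_forall fun ω hω => (hsub ω hω).le))
      integrable_condExp.integrableOn]
    rwa [inter_eq_right.mpr (show Y ⁻¹' F ⊆ Function.support G from
      fun ω hω => (hsub ω hω).ne')]
  have := hclosed F hF
  linarith

/-- The σ-algebra `sigmaF X i` is generated by the tuple of the first `i` maps. -/
lemma sigmaF_eq_comap {Ω : Type*} {d n : ℕ}
    (X : Fin n → Ω → EuclideanSpace ℝ (Fin d)) (i : ℕ) (hi : i ≤ n) :
    sigmaF X i = MeasurableSpace.comap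
      (fun ω (j : Fin i) => X ⟨j.1, lt_of_lt_of_le j.2 hi⟩ ω) inferInstance := by
  rw [sigmaF, MeasurableSpace.pi, MeasurableSpace.comap_iSup]
  simp only [MeasurableSpace.comap_comp]
  apply le_antisymm
  · refine iSup₂_le fun j hj => ?_
    refine le_trans ?_ (le_iSup _ (⟨j.1, hj⟩ : Fin i))
    rw [← BorelSpace.measurable_eq]
    exact le_rfl
  · refine iSup_le fun j => ?_
    refine le_trans ?_ (le_iSup₂ (⟨j.1, lt_of_lt_of_le j.2 hi⟩ : Fin n) j.2)
    rw [← BorelSpace.measurable_eq]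
    exact le_rfl

section SublinearExpectation

variable {Ω : Type*} [MeasurableSpace Ω] {Pset : Set (ProbabilityMeasure Ω)} {d : ℕ}

lemma integral_le_hatE {f : Ω → ℝ} {C : ℝ}
    (hC : ∀ P ∈ Pset, ∫ ω, f ω ∂(P : Measure Ω) ≤ C)
    {P : ProbabilityMeasure Ω} (hP : P ∈ Pset) :
    ∫ ω, f ω ∂(P : Measure Ω) ≤ hatE Pset f :=
  le_ciSup (f := fun P : Pset => ∫ ω, f ω ∂((P : ProbabilityMeasure Ω) : Measure Ω))
    ⟨C, by rintro _ ⟨Q, rfl⟩; exact hC Q Q.2⟩ ⟨P, hP⟩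

lemma hatE_le (hne : Pset.Nonempty) {f : Ω → ℝ} {C : ℝ}
    (hC : ∀ P ∈ Pset, ∫ ω, f ω ∂(P : Measure Ω) ≤ C) : hatE Pset f ≤ C :=
  haveI := hne.to_subtype
  ciSup_le fun Q => hC Q Q.2

lemma integral_le_of_abs_le (P : ProbabilityMeasure Ω) {f : Ω → ℝ} {C : ℝ}
    (hf : ∀ ω, |f ω| ≤ C) : ∫ ω, f ω ∂(P : Measure Ω) ≤ C := by
  have := norm_integral_le_of_norm_le_const (μ := (P : Measure Ω))
    (Filter.Eventually.of_forall fun ω => (Real.norm_eq_abs (f ω)).le.trans (hf ω))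
  simp only [probReal_univ, mul_one] at this
  exact (le_abs_self _).trans this

lemma HasBddMoment2.integrable {X : Ω → EuclideanSpace ℝ (Fin d)} (hmom : HasBddMoment2 Pset X)
    (hX : Measurable X) {P : ProbabilityMeasure Ω} (hP : P ∈ Pset) :
    Integrable X (P : Measure Ω) := by
  obtain ⟨C, hC⟩ := hmom
  refine Integrable.mono' ((integrable_const (1 : ℝ)).add (hC P hP).1) hX.aestronglyMeasurable
    (Filter.Eventually.of_forall fun ω => ?_)
  simp only [Pi.add_apply]
  nlinarith [sq_nonneg (‖X ω‖ - 1)]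

lemma HasBddMoment2.exists_integral_norm_le {X : Ω → EuclideanSpace ℝ (Fin d)}
    (hmom : HasBddMoment2 Pset X) (hX : Measurable X) :
    ∃ C, 0 ≤ C ∧ ∀ P ∈ Pset, ∫ ω, ‖X ω‖ ∂(P : Measure Ω) ≤ C := by
  obtain ⟨C, hC⟩ := id hmom
  refine ⟨1 + |C|, by positivity, fun P hP => ?_⟩
  calc ∫ ω, ‖X ω‖ ∂(P : Measure Ω) ≤ ∫ ω, (1 + ‖X ω‖ ^ 2) ∂(P : Measure Ω) := by
        refine integral_mono (hmom.integrable hX hP).norm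
          ((integrable_const (1 : ℝ)).add (hC P hP).1) fun ω => ?_
        simp only
        nlinarith [sq_nonneg (‖X ω‖ - 1)]
    _ = 1 + ∫ ω, ‖X ω‖ ^ 2 ∂(P : Measure Ω) := by
        rw [integral_add (integrable_const _) (hC P hP).1]; simp
    _ ≤ 1 + |C| := by linarith [(hC P hP).2, le_abs_self C]

lemma integral_inner_le {X : Ω → EuclideanSpace ℝ (Fin d)} {C : ℝ} {P : ProbabilityMeasure Ω}
    (hX : Integrable X (P : Measure Ω)) (hC : ∫ ω, ‖X ω‖ ∂(P : Measure Ω) ≤ C)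
    (p : EuclideanSpace ℝ (Fin d)) : ∫ ω, ⟪p, X ω⟫ ∂(P : Measure Ω) ≤ ‖p‖ * C :=
  calc ∫ ω, ⟪p, X ω⟫ ∂(P : Measure Ω) ≤ ∫ ω, ‖p‖ * ‖X ω‖ ∂(P : Measure Ω) :=
        integral_mono (hX.const_inner p) (hX.norm.const_mul _) fun ω => real_inner_le_norm _ _
    _ = ‖p‖ * ∫ ω, ‖X ω‖ ∂(P : Measure Ω) := integral_const_mul _ _
    _ ≤ ‖p‖ * C := by gcongr

/-- The support function `p ↦ Ê[⟨p, X⟩]` is Lipschitz. -/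
lemma continuous_hatE_inner (hne : Pset.Nonempty) {X : Ω → EuclideanSpace ℝ (Fin d)}
    (hmom : HasBddMoment2 Pset X) (hX : Measurable X) :
    Continuous fun p : EuclideanSpace ℝ (Fin d) => hatE Pset (fun ω => ⟪p, X ω⟫) := by
  obtain ⟨C, hC0, hC⟩ := hmom.exists_integral_norm_le hX
  refine (LipschitzWith.of_le_add_mul C.toNNReal fun p q => ?_).continuous
  rw [Real.coe_toNNReal _ hC0]
  refine hatE_le hne fun P hP => ?_
  have hint := hmom.integrable hX hP
  have h1 := integral_le_hatE (f := fun ω => ⟪q, X ω⟫)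
    (fun Q hQ => integral_inner_le (hmom.integrable hX hQ) (hC Q hQ) q) hP
  have h2 := integral_inner_le hint (hC P hP) (p - q)
  simp only [inner_sub_left] at h2
  rw [integral_sub (hint.const_inner p) (hint.const_inner q)] at h2
  rw [dist_eq_norm]
  linarith

/-- If the pair `(Y, X)` satisfies the defining identity of independence under `Ê`, then
`⟨p, X⟩ - Ê[⟨p, X⟩]` integrates nonpositively against `[0, 1]`-valued Lipschitz functions
of `Y`. -/
lemma integral_mul_inner_sub_hatE_nonpos {S : Type*} [PseudoMetricSpace S] [MeasurableSpace S]
    [BorelSpace S] (hne : Pset.Nonempty) {X : Ω → EuclideanSpace ℝ (Fin d)}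
    (hmom : HasBddMoment2 Pset X) (hX : Measurable X) {Y : Ω → S} (hY : Measurable Y)
    (hind : ∀ ψ : S × EuclideanSpace ℝ (Fin d) → ℝ, IsBLip ψ →
      hatE Pset (fun ω => ψ (Y ω, X ω))
        = hatE Pset (fun ω => hatE Pset (fun ω' => ψ (Y ω, X ω'))))
    {P : ProbabilityMeasure Ω} (hP : P ∈ Pset) (p : EuclideanSpace ℝ (Fin d))
    {φ : S → ℝ} (hφL : ∃ K : ℝ≥0, LipschitzWith K φ) (hφ0 : ∀ x, 0 ≤ φ x) (hφ1 : ∀ x, φ x ≤ 1) :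
    ∫ ω, φ (Y ω) * (⟪p, X ω⟫ - hatE Pset (fun ω' => ⟪p, X ω'⟫)) ∂(P : Measure Ω) ≤ 0 := by
  obtain ⟨C₁, hC₁0, hC₁⟩ := hmom.exists_integral_norm_le hX
  obtain ⟨C, hC⟩ := id hmom
  have hφb : ∀ x, |φ x| ≤ 1 := fun x => by rw [abs_of_nonneg (hφ0 x)]; exact hφ1 x
  have hφm : Measurable φ := by obtain ⟨K, hK⟩ := hφL; exact hK.continuous.measurable
  set m := hatE Pset (fun ω' => ⟪p, X ω'⟫) with hm
  set D := ‖p‖ ^ 2 * |C| with hD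
  have hZ : ∀ Q ∈ Pset, Integrable (fun ω => ⟪p, X ω⟫) (Q : Measure Ω) :=
    fun Q hQ => (hmom.integrable hX hQ).const_inner p
  have hTm : ∀ N, Measurable fun ω => truncReal N ⟪p, X ω⟫ := fun N =>
    (lipschitzWith_truncReal N).continuous.measurable.comp (measurable_const.inner hX)
  have hTi : ∀ N, 0 < N → ∀ Q : ProbabilityMeasure Ω,
      Integrable (fun ω => truncReal N ⟪p, X ω⟫) (Q : Measure Ω) := fun N hN Q =>
    Integrable.of_bound (hTm N).aestronglyMeasurable N
      (Filter.Eventually.of_forall fun ω => abs_truncReal_le hN.le _)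
  have htail : ∀ N, 0 < N → ∀ Q ∈ Pset,
      ∫ ω, |⟪p, X ω⟫ - truncReal N ⟪p, X ω⟫| ∂(Q : Measure Ω) ≤ D / N := by
    intro N hN Q hQ
    calc ∫ ω, |⟪p, X ω⟫ - truncReal N ⟪p, X ω⟫| ∂(Q : Measure Ω)
        ≤ ∫ ω, (‖p‖ ^ 2 / N) * ‖X ω‖ ^ 2 ∂(Q : Measure Ω) := by
          refine integral_mono ((hZ Q hQ).sub (hTi N hN Q)).abs ((hC Q hQ).1.const_mul _)
            fun ω => (abs_sub_truncReal_le hN _).trans ?_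
          have : ⟪p, X ω⟫ ^ 2 ≤ (‖p‖ * ‖X ω‖) ^ 2 :=
            sq_le_sq' (by linarith [neg_le_of_abs_le (abs_real_inner_le_norm p (X ω))])
              (real_inner_le_norm _ _)
          calc ⟪p, X ω⟫ ^ 2 / N ≤ (‖p‖ * ‖X ω‖) ^ 2 / N := by gcongr
            _ = _ := by ring
      _ = (‖p‖ ^ 2 / N) * ∫ ω, ‖X ω‖ ^ 2 ∂(Q : Measure Ω) := integral_const_mul _ _
      _ ≤ (‖p‖ ^ 2 / N) * |C| := by gcongr; exact (hC Q hQ).2.trans (le_abs_self C)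
      _ = D / N := by rw [hD]; ring
  have hbound : ∀ N, 0 < N → ∫ ω, φ (Y ω) * (⟪p, X ω⟫ - m) ∂(P : Measure Ω) ≤ 2 * D / N := by
    intro N hN
    set a := hatE Pset (fun ω' => truncReal N ⟪p, X ω'⟫) with ha
    have hTle : ∀ Q ∈ Pset, ∫ ω, truncReal N ⟪p, X ω⟫ ∂(Q : Measure Ω) ≤ a := fun Q hQ =>
      integral_le_hatE (f := fun ω => truncReal N ⟪p, X ω⟫)
        (fun R _ => integral_le_of_abs_le R fun ω => abs_truncReal_le hN.le _) hQ
    have ham : a ≤ m + D / N := by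
      refine hatE_le hne fun Q hQ => ?_
      have h1 : ∫ ω, ⟪p, X ω⟫ ∂(Q : Measure Ω) ≤ m :=
        integral_le_hatE (f := fun ω => ⟪p, X ω⟫)
          (fun R hR => integral_inner_le (hmom.integrable hX hR) (hC₁ R hR) p) hQ
      have h2 : ∫ ω, (truncReal N ⟪p, X ω⟫ - ⟪p, X ω⟫) ∂(Q : Measure Ω) ≤ D / N := by
        refine le_trans (integral_mono ((hTi N hN Q).sub (hZ Q hQ))
          ((hZ Q hQ).sub (hTi N hN Q)).abs fun ω => ?_) (htail N hN Q hQ)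
        simp only [Pi.sub_apply]
        rw [abs_sub_comm]
        exact le_abs_self _
      rw [integral_sub (hTi N hN Q) (hZ Q hQ)] at h2
      linarith
    have hψ : IsBLip fun z : S × EuclideanSpace ℝ (Fin d) =>
        φ z.1 * (truncReal N ⟪p, z.2⟫ - a) := by
      refine IsBLip.mul (IsBLip.comp ⟨hφL, 1, hφb⟩ LipschitzWith.prod_fst) ?_
      refine IsBLip.comp (f := fun y : EuclideanSpace ℝ (Fin d) => truncReal N ⟪p, y⟫ - a)
        ⟨⟨1 * ‖innerSL ℝ p‖₊ + 0, ?_⟩, N + |a|, fun y => ?_⟩ LipschitzWith.prod_snd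
      · exact ((lipschitzWith_truncReal N).comp (innerSL ℝ p).lipschitz).sub
          (LipschitzWith.const a)
      · exact (abs_sub _ _).trans (by gcongr; exact abs_truncReal_le hN.le _)
    obtain ⟨-, B, hB⟩ := id hψ
    have hle : ∫ ω, φ (Y ω) * (truncReal N ⟪p, X ω⟫ - a) ∂(P : Measure Ω) ≤ 0 := by
      refine (integral_le_hatE (f := fun ω => φ (Y ω) * (truncReal N ⟪p, X ω⟫ - a))
        (fun Q _ => integral_le_of_abs_le Q fun ω => hB (Y ω, X ω)) hP).trans ?_
      rw [hind _ hψ]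
      refine hatE_le hne fun Q _ => integral_nonpos fun ω => hatE_le hne fun R hR => ?_
      simp only
      rw [integral_const_mul, integral_sub (hTi N hN R) (integrable_const _)]
      simp only [integral_const, probReal_univ, one_smul]
      exact mul_nonpos_of_nonneg_of_nonpos (hφ0 _) (by linarith [hTle R hR])
    have hmul : ∀ {f : Ω → ℝ}, Integrable f (P : Measure Ω) →
        Integrable (fun ω => φ (Y ω) * f ω) (P : Measure Ω) := fun hf =>
      hf.bdd_mul (hφm.comp hY).aestronglyMeasurable
        (Filter.Eventually.of_forall fun ω => hφb (Y ω))
    have hT : Integrable (fun ω => truncReal N ⟪p, X ω⟫ - a) (P : Measure Ω) :=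
      (hTi N hN P).sub (integrable_const a)
    have hE : Integrable (fun ω => |⟪p, X ω⟫ - truncReal N ⟪p, X ω⟫|) (P : Measure Ω) :=
      ((hZ P hP).sub (hTi N hN P)).abs
    calc ∫ ω, φ (Y ω) * (⟪p, X ω⟫ - m) ∂(P : Measure Ω)
        ≤ ∫ ω, (φ (Y ω) * (truncReal N ⟪p, X ω⟫ - a)
            + (|⟪p, X ω⟫ - truncReal N ⟪p, X ω⟫| + D / N)) ∂(P : Measure Ω) := by
          refine integral_mono (hmul ((hZ P hP).sub (integrable_const m)))
            ((hmul hT).add (hE.add (integrable_const _))) fun ω => ?_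
          have h1 := le_abs_self (⟪p, X ω⟫ - truncReal N ⟪p, X ω⟫)
          have h2 : 0 ≤ |⟪p, X ω⟫ - truncReal N ⟪p, X ω⟫| + D / N := by positivity
          simp only
          nlinarith [hφ0 (Y ω), hφ1 (Y ω),
            mul_le_mul_of_nonneg_left h1 (hφ0 (Y ω)), mul_le_mul_of_nonneg_left ham (hφ0 (Y ω)),
            mul_le_mul_of_nonneg_right (hφ1 (Y ω)) h2]
      _ = ∫ ω, φ (Y ω) * (truncReal N ⟪p, X ω⟫ - a) ∂(P : Measure Ω)
            + (∫ ω, |⟪p, X ω⟫ - truncReal N ⟪p, X ω⟫| ∂(P : Measure Ω) + D / N) := by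
          have hED : Integrable (fun ω => |⟪p, X ω⟫ - truncReal N ⟪p, X ω⟫| + D / N)
              (P : Measure Ω) := hE.add (integrable_const _)
          rw [integral_add (hmul hT) hED, integral_add hE (integrable_const _)]
          simp
      _ ≤ 0 + (D / N + D / N) := by
          gcongr
          exact htail N hN P hP
      _ = 2 * D / N := by ring
  have hlim : Filter.Tendsto (fun N : ℝ => 2 * D / N) Filter.atTop (nhds 0) :=
    tendsto_const_nhds.div_atTop Filter.tendsto_id
  exact ge_of_tendsto hlim ((Filter.eventually_gt_atTop 0).mono hbound)

end SublinearExpectation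

/-- for independent `X_1, …, X_n` (0-indexed here) with uniformly bounded
second moments, the conditional expectation `E_P[X_i | F_{i-1}]` takes values in `Θ_i`
`P`-a.s., for every `P ∈ 𝒫`.  Here `sigmaF X i.1` is `σ(X_1, …, X_{i-1})`. -/
theorem condexp_mem_thetaSet
    {Ω : Type*} [MetricSpace Ω] [CompleteSpace Ω] [TopologicalSpace.SeparableSpace Ω]
    [MeasurableSpace Ω] [BorelSpace Ω]
    {d n : ℕ} (Pset : Set (ProbabilityMeasure Ω))
    (hne : Pset.Nonempty) (hconv : ConvexPM Pset) (hcomp : IsCompact Pset)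
    (X : Fin n → Ω → EuclideanSpace ℝ (Fin d))
    (hmeas : ∀ i, Measurable (X i))
    (hmom : ∀ i, HasBddMoment2 Pset (X i))
    (hindep : IndepUnder Pset X)
    (P : ProbabilityMeasure Ω) (hP : P ∈ Pset) (i : Fin n) :
    ∀ᵐ ω ∂(P : Measure Ω),
      ((P : Measure Ω)[(fun ω' => X i ω') | sigmaF X i.1]) ω ∈ ThetaSet Pset (X i) := by
  have hYm : Measurable (fun ω (j : Fin i.1) => X ⟨j.1, lt_of_lt_of_le j.2 i.2.le⟩ ω) :=
    measurable_pi_lambda _ fun j => hmeas _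
  have hXi : Integrable (X i) (P : Measure Ω) := (hmom i).integrable (hmeas i) hP
  have key : ∀ (p : EuclideanSpace ℝ (Fin d)) (φ : (Fin i.1 → EuclideanSpace ℝ (Fin d)) → ℝ),
      (∃ K : ℝ≥0, LipschitzWith K φ) → (∀ x, 0 ≤ φ x) → (∀ x, φ x ≤ 1) →
      ∫ ω, φ (fun j : Fin i.1 => X ⟨j.1, lt_of_lt_of_le j.2 i.2.le⟩ ω)
        * (⟪p, X i ω⟫ - hatE Pset (fun ω' => ⟪p, X i ω'⟫)) ∂(P : Measure Ω) ≤ 0 := by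
    intro p φ hφL hφ0 hφ1
    obtain ⟨i, hi⟩ := i
    cases i with
    | zero =>
      obtain ⟨C, -, hC⟩ := (hmom ⟨0, hi⟩).exists_integral_norm_le (hmeas _)
      have hle := integral_le_hatE (f := fun ω => ⟪p, X ⟨0, hi⟩ ω⟫)
        (fun Q hQ => integral_inner_le ((hmom _).integrable (hmeas _) hQ) (hC Q hQ) p) hP
      have hconst : ∀ x, φ x = φ 0 := fun x => by rw [Subsingleton.elim x 0]
      simp only [hconst]
      rw [integral_const_mul, integral_sub (hXi.const_inner p) (integrable_const _)]
      simp only [integral_const, probReal_univ, one_smul]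
      exact mul_nonpos_of_nonneg_of_nonpos (hφ0 _) (by linarith)
    | succ k =>
      exact integral_mul_inner_sub_hatE_nonpos hne (hmom _) (hmeas _) hYm
        (fun ψ hψ => hindep k hi ψ hψ) hP p hφL hφ0 hφ1
  have hm : sigmaF X i.1 ≤ ‹MeasurableSpace Ω› := by
    rw [sigmaF_eq_comap X i.1 i.2.le]
    exact hYm.comap_le
  have hp : ∀ p : EuclideanSpace ℝ (Fin d), ∀ᵐ ω ∂(P : Measure Ω),
      ⟪((P : Measure Ω)[(fun ω' => X i ω') | sigmaF X i.1]) ω, p⟫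
        ≤ hatE Pset (fun ω' => ⟪p, X i ω'⟫) := by
    intro p
    have h1 := condExp_comap_nonpos_of_lipschitz hYm
      ((hXi.const_inner p).sub (integrable_const (hatE Pset (fun ω' => ⟪p, X i ω'⟫)))) (key p)
    rw [← sigmaF_eq_comap X i.1 i.2.le] at h1
    have h2 := condExp_sub (m := sigmaF X i.1) (hXi.const_inner p)
      (integrable_const (hatE Pset (fun ω' => ⟪p, X i ω'⟫)))
    have h3 := (innerSL ℝ p).comp_condExp_comm (m := sigmaF X i.1) hXi
    filter_upwards [h1, h2, h3] with ω h1 h2 h3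
    rw [h2, Pi.sub_apply, condExp_const hm, Pi.zero_apply] at h1
    rw [real_inner_comm]
    have h4 : ⟪p, ((P : Measure Ω)[X i | sigmaF X i.1]) ω⟫
      = ((P : Measure Ω)[fun ω' => ⟪p, X i ω'⟫ | sigmaF X i.1]) ω := h3
    linarith
  obtain ⟨D, hDc, hDd⟩ := TopologicalSpace.exists_countable_dense (EuclideanSpace ℝ (Fin d))
  filter_upwards [(ae_ball_iff hDc).mpr fun p _ => hp p] with ω hω p
  have hclosed : IsClosed {p : EuclideanSpace ℝ (Fin d) |
      ⟪((P : Measure Ω)[(fun ω' => X i ω') | sigmaF X i.1]) ω, p⟫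
        ≤ hatE Pset (fun ω' => ⟪p, X i ω'⟫)} :=
    isClosed_le (continuous_const.inner continuous_id)
      (continuous_hatE_inner hne (hmom i) (hmeas i))
  exact hclosed.closure_subset_iff.mpr hω (hDd p)
end
end

section
/- Let X : Ω → ℝ be continuous with sup_{P ∈ 𝒫} E_P[X²] < ∞. Then {E_P[X] : P ∈ 𝒫} = [−Ê[−X], Ê[X]], the closed interval with left endpoint −Ê[−X] = inf_{P ∈ 𝒫} E_P[X] and right endpoint Ê[X] = sup_{P ∈ 𝒫} E_P[X]; in particular both endpoints are attained by some P ∈ 𝒫. -/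
open MeasureTheory Set
open scoped NNReal ENNReal RealInnerProductSpace

noncomputable section

variable {Ω : Type*} [MeasurableSpace Ω] [TopologicalSpace Ω]

lemma abs_sub_clamp_le {c : ℝ} (hc : 0 < c) (x : ℝ) :
    |x - max (-c) (min x c)| ≤ x ^ 2 / c := by
  rw [le_div_iff₀ hc]
  rcases le_total x c with h | h
  · rw [min_eq_left h]
    rcases le_total (-c) x with h' | h'
    · rw [max_eq_right h']
      simp only [sub_self, abs_zero, zero_mul]
      positivity
    · rw [max_eq_left h', abs_of_nonpos (by linarith)]
      nlinarith
  · rw [min_eq_right h, max_eq_right (by linarith), abs_of_nonneg (by linarith)]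
    nlinarith

lemma integrable_of_integrable_sq {Ω : Type*} [MeasurableSpace Ω]
    {μ : Measure Ω} [IsFiniteMeasure μ] {X : Ω → ℝ}
    (hX : AEStronglyMeasurable X μ) (h : Integrable (fun ω => X ω ^ 2) μ) : Integrable X μ :=
  ((memLp_two_iff_integrable_sq hX).2 h).integrable one_le_two

/-- The expectation of a continuous function is weakly continuous on any set of probability
measures over which the second moments of that function are uniformly bounded. -/
lemma continuousOn_integral_of_sq_le [OpensMeasurableSpace Ω] {S : Set (ProbabilityMeasure Ω)}
    {X : Ω → ℝ} (hX : Continuous X) {C : ℝ}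
    (hC : ∀ P ∈ S, Integrable (fun ω => X ω ^ 2) (P : Measure Ω) ∧
      ∫ ω, X ω ^ 2 ∂(P : Measure Ω) ≤ C) :
    ContinuousOn (fun P : ProbabilityMeasure Ω => ∫ ω, X ω ∂(P : Measure Ω)) S := by
  have hclamp (c : ℝ) (hc : 0 < c) (x : ℝ) : ‖max (-c) (min x c)‖ ≤ c :=
    abs_le.2 ⟨le_max_left _ _, max_le (by linarith) (min_le_right _ _)⟩
  let Y (n : ℕ) : BoundedContinuousFunction Ω ℝ :=
    .ofNormedAddCommGroup (fun ω => max (-(n + 1 : ℝ)) (min (X ω) (n + 1))) (by fun_prop)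
      (n + 1) fun ω => hclamp _ (by positivity) _
  refine TendstoUniformlyOn.continuousOn (p := Filter.atTop)
    (F := fun (n : ℕ) (P : ProbabilityMeasure Ω) => ∫ ω, Y n ω ∂(P : Measure Ω)) ?_
    (Filter.Eventually.of_forall fun n =>
      (ProbabilityMeasure.continuous_integral_boundedContinuousFunction
        (Y n)).continuousOn).frequently
  rw [Metric.tendstoUniformlyOn_iff]
  intro ε hε
  have hlim : Filter.Tendsto (fun n : ℕ => C / ((n : ℝ) + 1)) Filter.atTop (nhds 0) := by
    simpa [div_eq_mul_inv] using (tendsto_one_div_add_atTop_nhds_zero_nat (𝕜 := ℝ)).const_mul C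
  filter_upwards [hlim.eventually_lt_const hε] with n hn P hP
  obtain ⟨hint, hle⟩ := hC P hP
  have hXi := integrable_of_integrable_sq hX.aestronglyMeasurable hint
  have hpos : (0 : ℝ) < n + 1 := by positivity
  rw [Real.dist_eq, ← integral_sub hXi ((Y n).integrable _)]
  calc |∫ ω, (X ω - Y n ω) ∂(P : Measure Ω)|
      ≤ ∫ ω, |X ω - Y n ω| ∂(P : Measure Ω) := abs_integral_le_integral_abs
    _ ≤ ∫ ω, X ω ^ 2 / (n + 1) ∂(P : Measure Ω) :=
        integral_mono (hXi.sub ((Y n).integrable _)).abs (hint.div_const _)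
          fun ω => abs_sub_clamp_le hpos (X ω)
    _ = (∫ ω, X ω ^ 2 ∂(P : Measure Ω)) / (n + 1) := integral_div _ _
    _ ≤ C / (n + 1) := by gcongr
    _ < ε := hn

lemma ConvexPM.convex_image_integral {Ω : Type*} [MeasurableSpace Ω]
    {S : Set (ProbabilityMeasure Ω)} (hS : ConvexPM S)
    {X : Ω → ℝ} (hX : ∀ P ∈ S, Integrable X (P : Measure Ω)) :
    Convex ℝ ((fun P : ProbabilityMeasure Ω => ∫ ω, X ω ∂(P : Measure Ω)) '' S) := by
  rintro _ ⟨P, hP, rfl⟩ _ ⟨Q, hQ, rfl⟩ a b ha hb hab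
  lift a to ℝ≥0 using ha
  lift b to ℝ≥0 using hb
  have hab' : a + b = 1 := by exact_mod_cast hab
  obtain ⟨R, hR, hRe⟩ := hS P hP Q hQ a (hab' ▸ le_self_add)
  have hb' : 1 - a = b := by rw [← hab', add_tsub_cancel_left]
  refine ⟨R, hR, ?_⟩
  simp only [hRe, hb']
  rw [integral_add_measure ((hX P hP).smul_measure ENNReal.coe_ne_top)
    ((hX Q hQ).smul_measure ENNReal.coe_ne_top), integral_smul_measure, integral_smul_measure]
  simp

lemma neg_hatE_neg {Ω : Type*} [MeasurableSpace Ω]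
    (S : Set (ProbabilityMeasure Ω)) (X : Ω → ℝ) :
    -hatE S (fun ω => -X ω)
      = ⨅ P : S, ∫ ω, X ω ∂((P : ProbabilityMeasure Ω) : Measure Ω) := by
  simp only [hatE, integral_neg]
  rw [iInf, Real.sInf_def, iSup, ← Set.image_neg_eq_neg, ← Set.range_comp]
  rfl

/-- for a continuous real-valued `X` with uniformly bounded second moments,
`{E_P[X] : P ∈ 𝒫}` is the closed interval `[−Ê[−X], Ê[X]]`, the left endpoint equals
`inf_{P ∈ 𝒫} E_P[X]`, and both endpoints are attained. -/
theorem expectations_eq_Icc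
    {Ω : Type*} [MetricSpace Ω] [CompleteSpace Ω] [TopologicalSpace.SeparableSpace Ω]
    [MeasurableSpace Ω] [BorelSpace Ω]
    (Pset : Set (ProbabilityMeasure Ω))
    (hne : Pset.Nonempty) (hconv : ConvexPM Pset) (hcomp : IsCompact Pset)
    (X : Ω → ℝ) (hX : Continuous X)
    (hmom : ∃ C : ℝ, ∀ P ∈ Pset, Integrable (fun ω => (X ω) ^ 2)
        ((P : ProbabilityMeasure Ω) : Measure Ω) ∧
      ∫ ω, (X ω) ^ 2 ∂((P : ProbabilityMeasure Ω) : Measure Ω) ≤ C) :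
    {r : ℝ | ∃ P ∈ Pset, r = ∫ ω, X ω ∂((P : ProbabilityMeasure Ω) : Measure Ω)}
        = Set.Icc (-(hatE Pset (fun ω => -X ω))) (hatE Pset X) ∧
    -(hatE Pset (fun ω => -X ω))
        = ⨅ P : Pset, ∫ ω, X ω ∂((P : ProbabilityMeasure Ω) : Measure Ω) ∧
    (∃ P ∈ Pset, ∫ ω, X ω ∂((P : ProbabilityMeasure Ω) : Measure Ω)
        = -(hatE Pset (fun ω => -X ω))) ∧
    (∃ P ∈ Pset, ∫ ω, X ω ∂((P : ProbabilityMeasure Ω) : Measure Ω) = hatE Pset X) := by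
  obtain ⟨C, hC⟩ := hmom
  set E := fun P : ProbabilityMeasure Ω => ∫ ω, X ω ∂(P : Measure Ω)
  have hconvE : Convex ℝ (E '' Pset) := hconv.convex_image_integral fun P hP =>
    integrable_of_integrable_sq hX.aestronglyMeasurable (hC P hP).1
  have hcompE : IsCompact (E '' Pset) :=
    hcomp.image_of_continuousOn (continuousOn_integral_of_sq_le hX hC)
  have hneE : (E '' Pset).Nonempty := hne.image E
  have hIcc := eq_Icc_of_connected_compact ⟨hneE, hconvE.isPreconnected⟩ hcompE
  have hsup : hatE Pset X = sSup (E '' Pset) := by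
    rw [sSup_image']; rfl
  have hinf : -hatE Pset (fun ω => -X ω) = sInf (E '' Pset) := by
    rw [neg_hatE_neg, sInf_image']
  refine ⟨?_, neg_hatE_neg Pset X, ?_, ?_⟩
  · rw [hinf, hsup, ← hIcc]
    ext r
    exact exists_congr fun P => and_congr_right fun _ => eq_comm
  · rw [hinf]
    exact hcompE.sInf_mem hneE
  · rw [hsup]
    exact hcompE.sSup_mem hneE
end
end

section
/- Let X : Ω → ℝ^d be continuous with sup_{P ∈ 𝒫} E_P[|X|²] < ∞. Then the set {E_P[X] : P ∈ 𝒫} ⊆ ℝ^d is nonempty, convex and compact. -/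
open MeasureTheory Set
open scoped NNReal ENNReal RealInnerProductSpace

noncomputable section

variable {Ω : Type*} [MeasurableSpace Ω] [TopologicalSpace Ω]

/-- Truncating a real number at height `N` changes it by at most `x ^ 2 / N`. -/
lemma abs_sub_truncate_le {N : ℝ} (hN : 0 < N) (x : ℝ) :
    |x - max (-N) (min N x)| ≤ x ^ 2 / N := by
  rw [le_div_iff₀ hN]
  rcases le_total N x with h | h
  · rw [min_eq_left h, max_eq_right (by linarith), abs_of_nonneg (by linarith)]
    nlinarith
  · rw [min_eq_right h]
    rcases le_total (-N) x with h' | h'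
    · rw [max_eq_right h']
      simpa using sq_nonneg x
    · rw [max_eq_left h', abs_of_nonpos (by linarith)]
      nlinarith

lemma integrable_of_integrable_norm_sq {Ω E : Type*} [MeasurableSpace Ω] [NormedAddCommGroup E]
    {μ : Measure Ω} [IsFiniteMeasure μ] {f : Ω → E} (hf : AEStronglyMeasurable f μ)
    (h : Integrable (fun ω => ‖f ω‖ ^ 2) μ) : Integrable f μ :=
  ((memLp_two_iff_integrable_sq_norm hf).2 h).integrable one_le_two

/-- Integration of a continuous real function is weakly continuous on sets of probability measures
along which the second moments are bounded. -/
lemma continuousOn_integral_of_sq_bdd {Ω : Type*} [TopologicalSpace Ω] [MeasurableSpace Ω]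
    [OpensMeasurableSpace Ω] {S : Set (ProbabilityMeasure Ω)} {f : Ω → ℝ} (hf : Continuous f)
    {C : ℝ} (hint : ∀ P ∈ S, Integrable (fun ω => f ω ^ 2) (P : Measure Ω))
    (hC : ∀ P ∈ S, ∫ ω, f ω ^ 2 ∂(P : Measure Ω) ≤ C) :
    ContinuousOn (fun P : ProbabilityMeasure Ω => ∫ ω, f ω ∂(P : Measure Ω)) S := by
  refine continuousOn_of_uniform_approx_of_continuousOn fun u hu => ?_
  obtain ⟨ε, hε, hεu⟩ := Metric.mem_uniformity_dist.1 hu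
  set N : ℝ := (|C| + 1) / ε with hNdef
  have hN : 0 < N := by positivity
  let g : BoundedContinuousFunction Ω ℝ :=
    BoundedContinuousFunction.ofNormedAddCommGroup (fun ω => max (-N) (min N (f ω)))
      (by fun_prop) N fun ω => by
        rw [Real.norm_eq_abs, abs_le]
        exact ⟨le_max_left _ _, max_le (by linarith) (min_le_left _ _)⟩
  refine ⟨fun P => ∫ ω, g ω ∂(P : Measure Ω),
    (ProbabilityMeasure.continuous_integral_boundedContinuousFunction g).continuousOn,
    fun P hP => hεu ?_⟩
  have hfi : Integrable f (P : Measure Ω) :=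
    integrable_of_integrable_norm_sq hf.measurable.aestronglyMeasurable
      (by simpa using hint P hP)
  calc dist (∫ ω, f ω ∂(P : Measure Ω)) (∫ ω, g ω ∂(P : Measure Ω))
      = ‖∫ ω, (f ω - g ω) ∂(P : Measure Ω)‖ := by
        rw [dist_eq_norm, integral_sub hfi (g.integrable _)]
    _ ≤ ∫ ω, f ω ^ 2 / N ∂(P : Measure Ω) :=
        norm_integral_le_of_norm_le ((hint P hP).div_const N)
          (.of_forall fun ω => abs_sub_truncate_le hN (f ω))
    _ ≤ C / N := by
        rw [integral_div]
        gcongr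
        exact hC P hP
    _ < ε := by
        rw [div_lt_iff₀ hN, hNdef, mul_div_cancel₀ _ hε.ne']
        linarith [le_abs_self C]

/-- Integration of a continuous `ℝ^d`-valued map is weakly continuous on sets of probability
measures along which the second moments are bounded. -/
lemma HasBddMoment2.continuousOn_integral {Ω : Type*} [TopologicalSpace Ω] [MeasurableSpace Ω]
    [OpensMeasurableSpace Ω] {S : Set (ProbabilityMeasure Ω)} {d : ℕ}
    {X : Ω → EuclideanSpace ℝ (Fin d)} (hmom : HasBddMoment2 S X) (hX : Continuous X)
    (hint : ∀ P ∈ S, Integrable X (P : Measure Ω)) :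
    ContinuousOn (fun P : ProbabilityMeasure Ω => ∫ ω, X ω ∂(P : Measure Ω)) S := by
  obtain ⟨C, hC⟩ := hmom
  have hcoord (i : Fin d) : Continuous fun ω => X ω i := by fun_prop
  have hle (i : Fin d) (ω : Ω) : X ω i ^ 2 ≤ ‖X ω‖ ^ 2 := by
    rw [← sq_abs, ← Real.norm_eq_abs]
    gcongr
    exact PiLp.norm_apply_le (X ω) i
  have hsq (i : Fin d) (P) (hP : P ∈ S) : Integrable (fun ω => X ω i ^ 2) (P : Measure Ω) :=
    (hC P hP).1.mono' ((hcoord i).pow 2).measurable.aestronglyMeasurable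
      (.of_forall fun ω => by simpa using hle i ω)
  have hpi : ContinuousOn (fun P : ProbabilityMeasure Ω =>
      WithLp.ofLp (∫ ω, X ω ∂(P : Measure Ω))) S := by
    refine continuousOn_pi.2 fun i => ?_
    refine (continuousOn_integral_of_sq_bdd (hcoord i) (hsq i) (C := C) fun P hP =>
      (integral_mono (hsq i P hP) (hC P hP).1 (hle i)).trans (hC P hP).2).congr fun P hP => ?_
    exact eval_integral_piLp (fun j => (hint P hP).eval_piLp j) i
  exact (PiLp.continuous_toLp 2 _).comp_continuousOn hpi

/-- for a continuous `X : Ω → ℝ^d` with uniformly bounded second moments,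
the set `{E_P[X] : P ∈ 𝒫}` is nonempty, convex and compact. -/
theorem expectations_nonempty_convex_compact
    {Ω : Type*} [MetricSpace Ω] [CompleteSpace Ω] [TopologicalSpace.SeparableSpace Ω]
    [MeasurableSpace Ω] [BorelSpace Ω]
    {d : ℕ} (Pset : Set (ProbabilityMeasure Ω))
    (hne : Pset.Nonempty) (hconv : ConvexPM Pset) (hcomp : IsCompact Pset)
    (X : Ω → EuclideanSpace ℝ (Fin d)) (hX : Continuous X)
    (hmom : HasBddMoment2 Pset X) :
    ({θ | ∃ P ∈ Pset, θ = ∫ ω, X ω ∂((P : ProbabilityMeasure Ω) : Measure Ω)}).Nonempty ∧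
    Convex ℝ {θ | ∃ P ∈ Pset, θ = ∫ ω, X ω ∂((P : ProbabilityMeasure Ω) : Measure Ω)} ∧
    IsCompact {θ | ∃ P ∈ Pset, θ = ∫ ω, X ω ∂((P : ProbabilityMeasure Ω) : Measure Ω)} := by
  obtain ⟨C, hC⟩ := id hmom
  have hint (P) (hP : P ∈ Pset) : Integrable X (P : Measure Ω) :=
    integrable_of_integrable_norm_sq hX.aestronglyMeasurable (hC P hP).1
  refine ⟨hne.imp' _ fun P hP => ⟨P, hP, rfl⟩, ?_, ?_⟩
  · rintro _ ⟨P, hP, rfl⟩ _ ⟨Q, hQ, rfl⟩ a b ha hb hab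
    lift a to ℝ≥0 using ha
    lift b to ℝ≥0 using hb
    have hab' : a + b = 1 := by exact_mod_cast hab
    obtain ⟨R, hR, hReq⟩ := hconv P hP Q hQ a (hab' ▸ le_self_add)
    rw [← eq_tsub_of_add_eq ((add_comm b a).trans hab')] at hReq
    refine ⟨R, hR, ?_⟩
    rw [hReq, integral_add_measure ((hint P hP).smul_measure ENNReal.coe_ne_top)
      ((hint Q hQ).smul_measure ENNReal.coe_ne_top), integral_smul_measure, integral_smul_measure,
      ENNReal.coe_toReal, ENNReal.coe_toReal]
  · convert hcomp.image_of_continuousOn (hmom.continuousOn_integral hX hint) using 1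
    ext θ
    simp only [mem_ofPred_eq, mem_image, eq_comm]
end
end
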